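/- Let μ be a measure as in the context with μ(ℝ∖{0}) > 0. Let u, v : ℝ → ℝ be bounded continuous functions such that for every x ∈ ℝ the principal values D_μ u(x) and D_μ v(x) exist, D_μ u(x) ≥ 0 and D_μ v(x) ≤ 0 for all x ∈ ℝ, and the limits of (u − v)(x) as x → +∞ and as x → −∞ exist and are both ≤ 0. Then u(x) ≤ v(x) for every x ∈ ℝ. -/

import Mathlib

open MeasureTheory Filter Topology Set

/-- Truncated nonlocal operator `D_{μ,δ} u (x) = ∫_{|z| ≥ δ} (u(x+z) − u(x)) dμ(z)`. -/
noncomputable def Dtrunc (μ : Measure ℝ) (u : ℝ → ℝ) (δ : ℝ) (x : ℝ) : ℝ :=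
  ∫ z in {z : ℝ | δ ≤ |z|}, (u (x + z) - u x) ∂μ

/-- The principal value `D_μ u (x)` exists and equals `L`. -/
def HasPV (μ : Measure ℝ) (u : ℝ → ℝ) (x : ℝ) (L : ℝ) : Prop :=
  Tendsto (fun δ => Dtrunc μ u δ x) (𝓝[>] (0 : ℝ)) (𝓝 L)

/-- A symmetric diffuse Lévy measure as in the paper. -/
structure LevyMeasure (μ : Measure ℝ) : Prop where
  symm : Measure.map (fun z : ℝ => -z) μ = μ
  moment : ∫⁻ z, ENNReal.ofReal (min 1 (z ^ 2)) ∂μ < ⊤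
  diffuse : ∀ x : ℝ, x ≠ 0 → μ {x} = 0

/-- A bistable nonlinearity with threshold `θ`. -/
structure Bistable (f : ℝ → ℝ) (θ : ℝ) : Prop where
  smooth : ContDiff ℝ 1 f
  f0 : f 0 = 0
  f1 : f 1 = 0
  df1 : deriv f 1 < 0
  θ_mem : θ ∈ Set.Ioo (0 : ℝ) 1
  df0 : deriv f 0 < 0
  neg : ∀ s ∈ Set.Ioo (0 : ℝ) θ, f s < 0
  fθ : f θ = 0
  pos : ∀ s ∈ Set.Ioo θ (1 : ℝ), 0 < f s
  dfθ : 0 < deriv f θ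

/-- An ignition nonlinearity with threshold `θ`. -/
structure Ignition (f : ℝ → ℝ) (θ : ℝ) : Prop where
  smooth : ContDiff ℝ 1 f
  f1 : f 1 = 0
  df1 : deriv f 1 < 0
  θ_mem : θ ∈ Set.Ioo (0 : ℝ) 1
  zero : ∀ s ∈ Set.Icc (0 : ℝ) θ, f s = 0
  pos : ∀ s ∈ Set.Ioo θ (1 : ℝ), 0 < f s

/-- A monostable nonlinearity. -/
structure Monostable (f : ℝ → ℝ) : Prop where
  smooth : ContDiff ℝ 1 f
  f0 : f 0 = 0
  f1 : f 1 = 0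
  df1 : deriv f 1 < 0
  pos : ∀ s ∈ Set.Ioo (0 : ℝ) 1, 0 < f s


/-- Complements of neighbourhoods of the origin have finite measure. -/
theorem levy_finite (μ : Measure ℝ) (hμ : LevyMeasure μ) (δ : ℝ) (hδ : 0 < δ) :
    μ {z : ℝ | δ ≤ |z|} < ⊤ := by
  have hc : 0 < min 1 (δ ^ 2) := by positivity
  have h := meas_ge_le_lintegral_div (μ := μ)
    (f := fun z : ℝ => ENNReal.ofReal (min 1 (z ^ 2))) (by fun_prop)
    (ε := ENNReal.ofReal (min 1 (δ ^ 2))) (by simpa using hδ.ne') ENNReal.ofReal_ne_top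
  refine lt_of_le_of_lt (le_trans (measure_mono ?_) h) ?_
  · intro z hz
    simp only [mem_setOf_eq] at hz ⊢
    apply ENNReal.ofReal_le_ofReal
    apply min_le_min le_rfl
    rw [← sq_abs z]
    gcongr
  · exact ENNReal.div_lt_top hμ.moment.ne (by simpa using hδ.ne')

theorem levy_pos (μ : Measure ℝ) (hμ : LevyMeasure μ) (hμ0 : 0 < μ ({(0 : ℝ)}ᶜ)) :
    ∃ δ : ℝ, 0 < δ ∧ 0 < μ (Ici δ) := by
  by_contra! hcon
  have h1 : μ (Ioi 0) = 0 := by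
    have : Ioi (0 : ℝ) ⊆ ⋃ n : ℕ, Ici (1 / ((n : ℝ) + 1)) := by
      intro x hx
      obtain ⟨n, hn⟩ := exists_nat_one_div_lt (mem_Ioi.1 hx)
      exact mem_iUnion.2 ⟨n, hn.le⟩
    refine measure_mono_null this (measure_iUnion_null fun n => ?_)
    exact le_antisymm (hcon _ (by positivity)) bot_le
  have h2 : μ (Iio 0) = 0 := by
    rw [← hμ.symm, Measure.map_apply measurable_neg measurableSet_Iio]
    have : (fun z : ℝ => -z) ⁻¹' Iio 0 = Ioi 0 := by ext z; simp
    rw [this, h1]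
  have : μ ({(0 : ℝ)}ᶜ) = 0 := by
    rw [← Iio_union_Ioi]
    exact measure_union_null h2 h1
  exact hμ0.ne' this

theorem trunc_integrable (μ : Measure ℝ) (hμ : LevyMeasure μ) (u : ℝ → ℝ)
    (hub : ∃ M : ℝ, ∀ x, |u x| ≤ M) (huc : Continuous u) (δ : ℝ) (hδ : 0 < δ) (x : ℝ) :
    IntegrableOn (fun z => u (x + z) - u x) {z : ℝ | δ ≤ |z|} μ := by
  obtain ⟨M, hM⟩ := hub
  refine Measure.integrableOn_of_bounded (M := M + M) (levy_finite μ hμ δ hδ).ne ?_ ?_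
  · exact (by fun_prop : Continuous fun z => u (x + z) - u x).aestronglyMeasurable
  · refine Eventually.of_forall fun z => ?_
    rw [Real.norm_eq_abs]
    exact (abs_sub _ _).trans (add_le_add (hM _) (hM _))

/-- A continuous function positive somewhere and with nonpositive limits at infinity has a
greatest global maximizer. -/
theorem exists_last_max (w : ℝ → ℝ) (hw : Continuous w) (x₀ : ℝ) (h0 : 0 < w x₀)
    (htop : ∃ l : ℝ, l ≤ 0 ∧ Tendsto w atTop (𝓝 l))
    (hbot : ∃ l : ℝ, l ≤ 0 ∧ Tendsto w atBot (𝓝 l)) :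
    ∃ y, (∀ x, w x ≤ w y) ∧ ∀ z, 0 < z → w (y + z) < w y := by
  obtain ⟨l, hl, ht⟩ := htop
  obtain ⟨k, hk, hb⟩ := hbot
  obtain ⟨b, hb'⟩ := eventually_atTop.1 (ht.eventually_lt_const (hl.trans_lt h0))
  obtain ⟨a, ha'⟩ := eventually_atBot.1 (hb.eventually_lt_const (hk.trans_lt h0))
  have hin : ∀ x, w x₀ ≤ w x → x ∈ Icc a b := by
    intro x hx
    constructor
    · by_contra! h
      exact absurd (ha' x h.le) (not_lt.2 hx)
    · by_contra! h
      exact absurd (hb' x h.le) (not_lt.2 hx)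
  obtain ⟨m, hm, hmax⟩ := isCompact_Icc.exists_isMaxOn ⟨x₀, hin x₀ le_rfl⟩ hw.continuousOn
  have hx0m : w x₀ ≤ w m := hmax (hin x₀ le_rfl)
  have hglob : ∀ x, w x ≤ w m := by
    intro x
    by_cases h : w x₀ ≤ w x
    · exact hmax (hin x h)
    · exact (not_le.1 h).le.trans hx0m
  have hS : IsClosed {x | w m ≤ w x} := isClosed_le continuous_const hw
  have hbd : BddAbove {x | w m ≤ w x} := ⟨b, fun x hx => (hin x (hx0m.trans hx)).2⟩
  have hmem := hS.csSup_mem ⟨m, le_refl (w m)⟩ hbd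
  refine ⟨sSup {x | w m ≤ w x}, fun x => (hglob x).trans hmem, fun z hz => ?_⟩
  by_contra! h
  have := le_csSup hbd (show _ ∈ {x | w m ≤ w x} from le_trans hmem h)
  linarith

/-- elliptic type comparison principle (Theorem A.2, first case). -/
theorem elliptic_comparison_principle
    (μ : Measure ℝ) (hμ : LevyMeasure μ) (hμ0 : 0 < μ ({(0 : ℝ)}ᶜ))
    (u v : ℝ → ℝ)
    (hub : ∃ M : ℝ, ∀ x, |u x| ≤ M) (hvb : ∃ M : ℝ, ∀ x, |v x| ≤ M)
    (huc : Continuous u) (hvc : Continuous v)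
    (hu : ∀ x, ∃ L : ℝ, HasPV μ u x L ∧ 0 ≤ L)
    (hv : ∀ x, ∃ L : ℝ, HasPV μ v x L ∧ L ≤ 0)
    (htop : ∃ l : ℝ, l ≤ 0 ∧ Tendsto (fun x => u x - v x) atTop (𝓝 l))
    (hbot : ∃ l : ℝ, l ≤ 0 ∧ Tendsto (fun x => u x - v x) atBot (𝓝 l)) :
    ∀ x, u x ≤ v x := by
  by_contra! hcon
  obtain ⟨x₀, hx₀⟩ := hcon
  obtain ⟨y, hmax, hlt⟩ := exists_last_max (fun x => u x - v x) (huc.sub hvc) x₀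
    (sub_pos.2 hx₀) htop hbot
  obtain ⟨δ, hδ, hpos⟩ := levy_pos μ hμ hμ0
  obtain ⟨L, hL, hL0⟩ := hu y
  obtain ⟨K, hK, hK0⟩ := hv y
  set g : ℝ → ℝ := fun z => (v (y + z) - v y) - (u (y + z) - u y) with hg
  have hg0 : ∀ z, 0 ≤ g z := fun z => by
    have := hmax (y + z)
    simp only [hg]; linarith
  have hgi : ∀ ε, 0 < ε → IntegrableOn g {z : ℝ | ε ≤ |z|} μ := fun ε hε =>
    (trunc_integrable μ hμ v hvb hvc ε hε y).sub (trunc_integrable μ hμ u hub huc ε hε y)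
  have heq : ∀ ε, 0 < ε → ∫ z in {z : ℝ | ε ≤ |z|}, g z ∂μ = Dtrunc μ v ε y - Dtrunc μ u ε y :=
    fun ε hε => integral_sub (trunc_integrable μ hμ v hvb hvc ε hε y)
      (trunc_integrable μ hμ u hub huc ε hε y)
  have hle : ∫ z in {z : ℝ | δ ≤ |z|}, g z ∂μ ≤ K - L := by
    refine ge_of_tendsto (hK.sub hL) ?_
    filter_upwards [Ioo_mem_nhdsGT hδ] with ε hε
    rw [← heq ε hε.1]
    refine setIntegral_mono_set (hgi ε hε.1) (Eventually.of_forall hg0) ?_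
    exact HasSubset.Subset.eventuallyLE fun z hz => hε.2.le.trans hz
  have hgt : 0 < ∫ z in {z : ℝ | δ ≤ |z|}, g z ∂μ := by
    rw [setIntegral_pos_iff_support_of_nonneg_ae (Eventually.of_forall hg0) (hgi δ hδ)]
    refine hpos.trans_le (measure_mono fun z hz => ⟨?_, ?_⟩)
    · have := hlt z (hδ.trans_le hz)
      have h2 : 0 < g z := by simp only [hg]; linarith
      exact h2.ne'
    · exact le_trans hz (le_abs_self z)
  linarith
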